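/- Fix β ∈ (−1,1). As Δ = 2−α → 0⁺, the mixed Fisher information of location and scale converges to zero: I_{μσ}(α) = ∫_ℝ f′(x;α,β)·(f(x;α,β) + x·f′(x;α,β)) / f(x;α,β) dx → 0. -/

import Mathlib

open MeasureTheory Filter Set Topology Real

/-- Shift parameter ζ = −β·tan(πα/2) in Zolotarev's (M) parameterization. -/
noncomputable def zetaPar (α β : ℝ) : ℝ := -β * Real.tan (Real.pi * α / 2)

/-- Standard stable density in Zolotarev's (M) parameterization, via the inversion formula. -/
noncomputable def stableDensity (α β x : ℝ) : ℝ :=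
  (1 / Real.pi) *
    (∫ t in Set.Ioi (0 : ℝ),
      Complex.exp (-(Complex.I * (t : ℂ) * (x : ℂ))) *
        Complex.exp (-(((t ^ α : ℝ) : ℂ)) *
          (1 + Complex.I * (β : ℂ) * ((Real.tan (Real.pi * α / 2) : ℝ) : ℂ) *
            (((t ^ (1 - α) : ℝ) : ℂ) - 1)))).re

/-- The N(0,2) density f(y;2). -/
noncomputable def normalDensity (y : ℝ) : ℝ :=
  (1 / (2 * Real.sqrt Real.pi)) * Real.exp (-(y ^ 2) / 4)

/-- Partial derivative of the stable density with respect to α. -/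
noncomputable def fAlpha (α β x : ℝ) : ℝ := deriv (fun a : ℝ => stableDensity a β x) α

/-- Partial derivative of the stable density with respect to β. -/
noncomputable def fBeta (α β x : ℝ) : ℝ := deriv (fun b : ℝ => stableDensity α b x) β

/-- Derivative of the stable density in x. -/
noncomputable def fX (α β x : ℝ) : ℝ := deriv (stableDensity α β) x

/-- The scale score numerator f_σ = −f − x·f′. -/
noncomputable def fSig (α β x : ℝ) : ℝ := -stableDensity α β x - x * fX α β x


/-! ### Positive-definiteness machinery -/

/-- Bounded measurable functions whose Gaussian-regularised Fourier integrals are nonnegative. -/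
def GoodFn (Φ : ℝ → ℂ) : Prop :=
  Measurable Φ ∧ (∃ C : ℝ, ∀ t, ‖Φ t‖ ≤ C) ∧
    ∀ x ε : ℝ, 0 < ε →
      0 ≤ (∫ t : ℝ, Complex.exp (Complex.I * (x : ℂ) * t) *
        Complex.exp (-(ε : ℂ) * (t : ℂ) ^ 2) * Φ t).re

/-- Multipliers preserving `GoodFn`. -/
def MultFn (m : ℝ → ℂ) : Prop :=
  Measurable m ∧ (∀ t, ‖m t‖ ≤ (m 0).re) ∧ ∀ Φ, GoodFn Φ → GoodFn (fun t => m t * Φ t)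

theorem norm_exp_I_mul (x t : ℝ) : ‖Complex.exp (Complex.I * (x : ℂ) * t)‖ = 1 := by
  rw [Complex.norm_exp]; simp

theorem norm_exp_gauss (ε t : ℝ) :
    ‖Complex.exp (-(ε : ℂ) * (t : ℂ) ^ 2)‖ = Real.exp (-ε * t ^ 2) := by
  rw [Complex.norm_exp]
  congr 1
  norm_cast

theorem good_integrable {Φ : ℝ → ℂ} (hm : Measurable Φ) {C : ℝ} (hC : ∀ t, ‖Φ t‖ ≤ C)
    (x : ℝ) {ε : ℝ} (hε : 0 < ε) :
    Integrable (fun t : ℝ => Complex.exp (Complex.I * (x : ℂ) * t) *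
        Complex.exp (-(ε : ℂ) * (t : ℂ) ^ 2) * Φ t) := by
  refine Integrable.mono' ((integrable_exp_neg_mul_sq hε).mul_const C) ?_ ?_
  · apply Measurable.aestronglyMeasurable
    fun_prop
  · refine Eventually.of_forall fun t => ?_
    rw [norm_mul, norm_mul, norm_exp_I_mul, norm_exp_gauss, one_mul]
    exact mul_le_mul_of_nonneg_left (hC t) (Real.exp_pos _).le

theorem good_one : GoodFn (fun _ => 1) := by
  refine ⟨measurable_const, ⟨1, by simp⟩, fun x ε hε => ?_⟩
  simp only [mul_one]
  rw [fourierIntegral_gaussian (by simpa using hε)]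
  have h1 : ((π : ℂ) / (ε : ℂ)) ^ (1 / 2 : ℂ) = (((π / ε) ^ (1 / 2 : ℝ) : ℝ) : ℂ) := by
    rw [Complex.ofReal_cpow (by positivity)]
    push_cast
    rfl
  have h2 : Complex.exp (-(x : ℂ) ^ 2 / (4 * (ε : ℂ))) = ((Real.exp (-x ^ 2 / (4 * ε)) : ℝ) : ℂ) := by
    push_cast
    rfl
  rw [h1, h2, ← Complex.ofReal_mul, Complex.ofReal_re]
  positivity

theorem good_char {Φ : ℝ → ℂ} (h : GoodFn Φ) (s : ℝ) :
    GoodFn (fun t : ℝ => Complex.exp (Complex.I * (s : ℂ) * t) * Φ t) := by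
  obtain ⟨hm, ⟨C, hC⟩, hp⟩ := h
  refine ⟨by fun_prop, ⟨C, fun t => ?_⟩, fun x ε hε => ?_⟩
  · rw [norm_mul, norm_exp_I_mul, one_mul]
    exact hC t
  · convert hp (x + s) ε hε using 3
    ext t
    have : Complex.exp (Complex.I * ((x + s : ℝ) : ℂ) * t) =
      Complex.exp (Complex.I * (x : ℂ) * t) * Complex.exp (Complex.I * (s : ℂ) * t) := by
      rw [← Complex.exp_add]
      push_cast
      ring_nf
    rw [this]
    ring

theorem good_add {Φ Ψ : ℝ → ℂ} (h : GoodFn Φ) (h' : GoodFn Ψ) :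
    GoodFn (fun t : ℝ => Φ t + Ψ t) := by
  obtain ⟨hm, ⟨C, hC⟩, hp⟩ := h
  obtain ⟨hm', ⟨C', hC'⟩, hp'⟩ := h'
  refine ⟨by fun_prop, ⟨C + C', fun t => (norm_add_le _ _).trans (add_le_add (hC t) (hC' t))⟩,
    fun x ε hε => ?_⟩
  simp only [mul_add]
  rw [integral_add (good_integrable hm hC x hε) (good_integrable hm' hC' x hε), Complex.add_re]
  exact add_nonneg (hp x ε hε) (hp' x ε hε)

theorem good_smul {Φ : ℝ → ℂ} (h : GoodFn Φ) {c : ℝ} (hc : 0 ≤ c) :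
    GoodFn (fun t : ℝ => (c : ℂ) * Φ t) := by
  obtain ⟨hm, ⟨C, hC⟩, hp⟩ := h
  refine ⟨by fun_prop, ⟨c * C, fun t => ?_⟩, fun x ε hε => ?_⟩
  · rw [norm_mul, Complex.norm_real, Real.norm_of_nonneg hc]
    exact mul_le_mul_of_nonneg_left (hC t) hc
  · simp only [mul_left_comm _ (c : ℂ)]
    rw [integral_const_mul, Complex.re_ofReal_mul]
    exact mul_nonneg hc (hp x ε hε)

theorem good_lim {Φ : ℕ → ℝ → ℂ} {Ψ : ℝ → ℂ} {C : ℝ} (h : ∀ n, GoodFn (Φ n))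
    (hC : ∀ n t, ‖Φ n t‖ ≤ C) (hl : ∀ t, Tendsto (fun n => Φ n t) atTop (𝓝 (Ψ t))) :
    GoodFn Ψ := by
  refine ⟨measurable_of_tendsto_metrizable (fun n => (h n).1) (tendsto_pi_nhds.2 hl),
    ⟨C, fun t => le_of_tendsto (hl t).norm (Eventually.of_forall fun n => hC n t)⟩,
    fun x ε hε => ?_⟩
  have key : Tendsto (fun n => ∫ t : ℝ, Complex.exp (Complex.I * (x : ℂ) * t) *
        Complex.exp (-(ε : ℂ) * (t : ℂ) ^ 2) * Φ n t) atTop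
        (𝓝 (∫ t : ℝ, Complex.exp (Complex.I * (x : ℂ) * t) *
        Complex.exp (-(ε : ℂ) * (t : ℂ) ^ 2) * Ψ t)) := by
    refine tendsto_integral_of_dominated_convergence (fun t => Real.exp (-ε * t ^ 2) * C)
      (fun n => (good_integrable (h n).1 (hC n) x hε).aestronglyMeasurable)
      ((integrable_exp_neg_mul_sq hε).mul_const C) (fun n => Eventually.of_forall fun t => ?_)
      (Eventually.of_forall fun t => (hl t).const_mul _)
    rw [norm_mul, norm_mul, norm_exp_I_mul, norm_exp_gauss, one_mul]
    exact mul_le_mul_of_nonneg_left (hC n t) (Real.exp_pos _).le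
  exact ge_of_tendsto ((Complex.continuous_re.tendsto _).comp key)
    (Eventually.of_forall fun n => (h n).2.2 x ε hε)

theorem mult_im {m : ℝ → ℂ} (h : MultFn m) : (m 0).im = 0 := by
  have h1 := h.2.1 0
  have h2 : ‖m 0‖ ^ 2 = (m 0).re ^ 2 + (m 0).im ^ 2 := by
    rw [← Complex.normSq_eq_norm_sq, Complex.normSq_apply]; ring
  have h3 : ‖m 0‖ ^ 2 ≤ (m 0).re ^ 2 := pow_le_pow_left₀ (norm_nonneg _) h1 2
  nlinarith [sq_nonneg (m 0).im]

theorem mult_const {c : ℝ} (hc : 0 ≤ c) : MultFn (fun _ => (c : ℂ)) := by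
  refine ⟨measurable_const, fun t => ?_, fun Φ h => good_smul h hc⟩
  rw [Complex.norm_real, Real.norm_of_nonneg hc, Complex.ofReal_re]

theorem mult_char (s : ℝ) : MultFn (fun t : ℝ => Complex.exp (Complex.I * (s : ℂ) * t)) := by
  refine ⟨by fun_prop, fun t => ?_, fun Φ h => good_char h s⟩
  rw [norm_exp_I_mul]
  simp

theorem mult_add {m n : ℝ → ℂ} (h : MultFn m) (h' : MultFn n) : MultFn (fun t => m t + n t) := by
  refine ⟨h.1.add h'.1, fun t => ?_, fun Φ hΦ => ?_⟩
  · rw [Complex.add_re]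
    exact (norm_add_le _ _).trans (add_le_add (h.2.1 t) (h'.2.1 t))
  · simp only [add_mul]
    exact good_add (h.2.2 Φ hΦ) (h'.2.2 Φ hΦ)

theorem mult_mul {m n : ℝ → ℂ} (h : MultFn m) (h' : MultFn n) : MultFn (fun t => m t * n t) := by
  refine ⟨h.1.mul h'.1, fun t => ?_, fun Φ hΦ => ?_⟩
  · rw [Complex.mul_re, mult_im h, zero_mul, sub_zero, norm_mul]
    exact mul_le_mul (h.2.1 t) (h'.2.1 t) (norm_nonneg _) ((norm_nonneg _).trans (h.2.1 t))
  · simp only [mul_assoc]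
    exact h.2.2 _ (h'.2.2 Φ hΦ)

theorem mult_pow {m : ℝ → ℂ} (h : MultFn m) (k : ℕ) : MultFn (fun t => m t ^ k) := by
  induction k with
  | zero => simpa using mult_const (c := 1) zero_le_one
  | succ k ih => simpa only [pow_succ] using mult_mul ih h

theorem mult_sum {m : ℕ → ℝ → ℂ} (h : ∀ n, MultFn (m n)) (k : ℕ) :
    MultFn (fun t => ∑ i ∈ Finset.range k, m i t) := by
  induction k with
  | zero => simpa using mult_const (c := 0) le_rfl
  | succ k ih => simpa only [Finset.sum_range_succ] using mult_add ih (h k)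

theorem mult_lim {m : ℕ → ℝ → ℂ} {p : ℝ → ℂ} (h : ∀ n, MultFn (m n))
    (hl : ∀ t, Tendsto (fun n => m n t) atTop (𝓝 (p t))) : MultFn p := by
  have hre : Tendsto (fun n => (m n 0).re) atTop (𝓝 (p 0).re) :=
    (Complex.continuous_re.tendsto _).comp (hl 0)
  refine ⟨measurable_of_tendsto_metrizable (fun n => (h n).1) (tendsto_pi_nhds.2 hl),
    fun t => le_of_tendsto_of_tendsto' (hl t).norm hre (fun n => (h n).2.1 t), fun Φ hΦ => ?_⟩
  obtain ⟨B, hB⟩ := hre.bddAbove_range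
  obtain ⟨C, hC⟩ := hΦ.2.1
  refine good_lim (Φ := fun n t => m n t * Φ t) (C := B * C) (fun n => (h n).2.2 Φ hΦ) (fun n t => ?_)
    (fun t => (hl t).mul_const _)
  have h1 : (m n 0).re ≤ B := hB ⟨n, rfl⟩
  rw [norm_mul]
  exact mul_le_mul (((h n).2.1 t).trans h1) (hC t) (norm_nonneg _)
    ((norm_nonneg _).trans (((h n).2.1 t).trans h1))

theorem mult_hasSum {m : ℕ → ℝ → ℂ} {p : ℝ → ℂ} (h : ∀ n, MultFn (m n))
    (hl : ∀ t, HasSum (fun n => m n t) (p t)) : MultFn p :=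
  mult_lim (mult_sum h) (fun t => (hl t).tendsto_sum_nat)

theorem mult_exp {m : ℝ → ℂ} (h : MultFn m) : MultFn (fun t => Complex.exp (m t)) := by
  refine mult_hasSum (m := fun n t => (((1 / (n.factorial : ℝ)) : ℝ) : ℂ) * m t ^ n)
    (fun n => mult_mul (mult_const (by positivity)) (mult_pow h n)) (fun t => ?_)
  have := NormedSpace.expSeries_div_hasSum_exp (𝔸 := ℂ) (m t)
  rw [← Complex.exp_eq_exp_ℂ] at this
  convert! this using 2 with n
  push_cast
  ring


/-! ### Grünwald–Letnikov approximation of the stable exponent -/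

/-- Coefficients of `(1 - w) ^ a`. -/
noncomputable def gcoef (a : ℝ) (n : ℕ) : ℝ := (-1) ^ n * Ring.choose a n

theorem gcoef_zero (a : ℝ) : gcoef a 0 = 1 := by simp [gcoef]

theorem gcoef_one (a : ℝ) : gcoef a 1 = -a := by simp [gcoef]

theorem gcoef_succ (a : ℝ) (n : ℕ) : gcoef a (n + 1) * (n + 1) = gcoef a n * (n - a) := by
  have h0 := Ring.descPochhammer_eq_factorial_smul_choose a n
  have h1 := Ring.descPochhammer_eq_factorial_smul_choose a (n + 1)
  rw [descPochhammer_succ_right, Polynomial.smeval_mul, h0] at h1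
  have h2 : (Polynomial.X - (n : Polynomial ℤ)).smeval a = a - n := by
    rw [Polynomial.smeval_sub, Polynomial.smeval_X, pow_one]
    simp [Polynomial.smeval_natCast]
  rw [h2, Nat.factorial_succ] at h1
  simp only [nsmul_eq_mul] at h1
  push_cast at h1
  have h3 : (n.factorial : ℝ) ≠ 0 := by positivity
  have h4 : Ring.choose a n * (a - n) = (n + 1) * Ring.choose a (n + 1) := by
    apply mul_left_cancel₀ h3
    linear_combination h1
  simp only [gcoef, pow_succ]
  linear_combination (-1) ^ n * h4

theorem gcoef_nonneg {a : ℝ} (h1 : 1 < a) (h2 : a < 2) (n : ℕ) : 0 ≤ gcoef a (n + 2) := by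
  induction n with
  | zero =>
    have := gcoef_succ a 1
    rw [gcoef_one] at this
    push_cast at this
    norm_num at this ⊢
    nlinarith
  | succ n ih =>
    have := gcoef_succ a (n + 2)
    push_cast at this
    have hn : (0 : ℝ) ≤ n := n.cast_nonneg
    have h3 : 0 ≤ gcoef a (n + 2 + 1) * (n + 2 + 1) := by
      rw [this]; exact mul_nonneg ih (by linarith)
    exact nonneg_of_mul_nonneg_left h3 (by positivity)

theorem gcoef_hasSum (a : ℝ) {w : ℂ} (hw : ‖w‖ < 1) :
    HasSum (fun n => (gcoef a n : ℂ) * w ^ n) ((1 - w) ^ (a : ℂ)) := by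
  have h := (Complex.one_add_cpow_hasFPowerSeriesOnBall_zero (a := (a : ℂ))).hasSum (y := -w)
    (by
      rw [Metric.mem_eball, edist_zero_right, enorm_neg, ← ofReal_norm]
      exact ENNReal.ofReal_lt_one.2 hw)
  simp only [zero_add] at h
  rw [← sub_eq_add_neg] at h
  convert! h using 2 with n
  rw [binomialSeries_apply, ← Complex.ofReal_choose]
  simp [gcoef, List.ofFn_const, List.prod_replicate, neg_pow w]
  ring

theorem gcoef_hasSum' (a : ℝ) {w : ℂ} (hw : ‖w‖ < 1) (h0 : w ≠ 0) :
    HasSum (fun n => (gcoef a (n + 2) : ℂ) * w ^ (n + 1)) (w⁻¹ * (1 - w) ^ (a : ℂ) - w⁻¹ + a) := by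
  have h := (hasSum_nat_add_iff' 2).2 (gcoef_hasSum a hw)
  have h' := h.mul_left w⁻¹
  convert! h' using 1
  · ext n
    rw [pow_succ _ (n + 1)]
    field_simp
  · rw [Finset.sum_range_succ, Finset.sum_range_one, gcoef_zero, gcoef_one]
    push_cast
    field_simp
    ring

theorem mult_shift (σ ε s : ℝ) :
    MultFn (fun t : ℝ => Complex.exp (-((ε : ℂ) - Complex.I * σ * t) * s)) := by
  have h := mult_mul (mult_const (Real.exp_pos (-(ε * s))).le) (mult_char (σ * s))
  convert h using 2 with t
  push_cast
  rw [← Complex.exp_add]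
  ring_nf

theorem mult_grun {a : ℝ} (h1 : 1 < a) (h2 : a < 2) (σ : ℝ) {ε h K : ℝ} (hε : 0 < ε) (hh : 0 < h)
    (hK : 0 ≤ K) :
    MultFn (fun t : ℝ => Complex.exp ((K : ℂ) *
      ((Complex.exp (-((ε : ℂ) - Complex.I * σ * t) * h))⁻¹ *
        (1 - Complex.exp (-((ε : ℂ) - Complex.I * σ * t) * h)) ^ (a : ℂ)))) := by
  have hN : MultFn (fun t : ℝ => (Complex.exp (-((ε : ℂ) - Complex.I * σ * t) * h))⁻¹ *
        (1 - Complex.exp (-((ε : ℂ) - Complex.I * σ * t) * h)) ^ (a : ℂ) -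
        (Complex.exp (-((ε : ℂ) - Complex.I * σ * t) * h))⁻¹ + a) := by
    refine mult_hasSum (m := fun n t => (gcoef a (n + 2) : ℂ) *
      (Complex.exp (-((ε : ℂ) - Complex.I * σ * t) * h)) ^ (n + 1))
      (fun n => mult_mul (mult_const (gcoef_nonneg h1 h2 n)) (mult_pow (mult_shift σ ε h) _))
      (fun t => gcoef_hasSum' a ?_ (Complex.exp_ne_zero _))
    rw [Complex.norm_exp]
    apply Real.exp_lt_one_iff.2
    simp
    positivity
  have h3 := mult_add hN (mult_shift σ ε (-h))
  have h4 := mult_mul (mult_const (Real.exp_pos (-(K * a))).le) (mult_exp (mult_mul (mult_const hK) h3))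
  convert h4 using 2 with t
  push_cast
  rw [← Complex.exp_add, ← Complex.exp_neg]
  ring_nf

theorem real_mul_cpow {r : ℝ} (hr : 0 < r) {z : ℂ} (hz : z ≠ 0) (a : ℝ) :
    ((r : ℂ) * z) ^ (a : ℂ) = ((r ^ a : ℝ) : ℂ) * z ^ (a : ℂ) := by
  have hr' : (r : ℂ) ≠ 0 := by exact_mod_cast hr.ne'
  rw [Complex.ofReal_cpow hr.le, Complex.cpow_def_of_ne_zero (mul_ne_zero hr' hz),
    Complex.cpow_def_of_ne_zero hr', Complex.cpow_def_of_ne_zero hz, Complex.log_ofReal_mul hr hz,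
    ← Complex.exp_add, ← Complex.ofReal_log hr.le]
  ring_nf

theorem mult_tempered {a : ℝ} (h1 : 1 < a) (h2 : a < 2) (σ : ℝ) {ε k : ℝ} (hε : 0 < ε)
    (hk : 0 ≤ k) :
    MultFn (fun t : ℝ => Complex.exp ((k : ℂ) * ((ε : ℂ) - Complex.I * σ * t) ^ (a : ℂ))) := by
  have hpos : ∀ n : ℕ, 0 < (1 / ((n : ℝ) + 1)) := fun n => by positivity
  refine mult_lim (fun n => mult_grun h1 h2 σ hε (hpos n)
    (K := k * ((1 / ((n : ℝ) + 1))⁻¹) ^ a) (by positivity)) (fun t => ?_)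
  set z : ℂ := (ε : ℂ) - Complex.I * σ * t with hz
  have hzre : z.re = ε := by simp [hz]
  have hlim0 : Tendsto (fun n : ℕ => (1 / ((n : ℝ) + 1))) atTop (𝓝[≠] 0) :=
    tendsto_nhdsWithin_iff.2 ⟨tendsto_one_div_add_atTop_nhds_zero_nat,
      Eventually.of_forall fun n => (hpos n).ne'⟩
  have hd : HasDerivAt (fun h : ℝ => 1 - Complex.exp (-z * h)) z 0 := by
    have hA : HasDerivAt (fun h : ℝ => -z * (h : ℂ)) (-z) 0 := by
      simpa using (Complex.ofRealCLM.hasDerivAt (x := (0 : ℝ))).const_mul (-z)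
    have hB := (hA.cexp).const_sub 1
    simpa using hB
  have hq : Tendsto (fun n : ℕ => (((1 / ((n : ℝ) + 1))⁻¹ : ℝ) : ℂ) *
      (1 - Complex.exp (-z * ((1 / ((n : ℝ) + 1) : ℝ) : ℂ)))) atTop (𝓝 z) := by
    have := (hasDerivAt_iff_tendsto_slope_zero.1 hd).comp hlim0
    simpa [Function.comp_def] using this
  have hw : Tendsto (fun n : ℕ => (Complex.exp (-z * ((1 / ((n : ℝ) + 1) : ℝ) : ℂ)))⁻¹) atTop
      (𝓝 1) := by
    have hc : Continuous (fun h : ℝ => (Complex.exp (-z * (h : ℂ)))⁻¹) := by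
      simp only [← Complex.exp_neg]
      fun_prop
    have := (hc.tendsto 0).comp tendsto_one_div_add_atTop_nhds_zero_nat
    simpa [Function.comp_def] using this
  have hqa := ((continuousAt_cpow_const (b := (a : ℂ))
    (Complex.mem_slitPlane_iff.2 (Or.inl (by rw [hzre]; exact hε)))).tendsto).comp hq
  have hfin := (Complex.continuous_exp.tendsto _).comp ((hw.mul hqa).const_mul (k : ℂ))
  rw [one_mul] at hfin
  refine hfin.congr fun n => ?_
  simp only [Function.comp_def]
  congr 1
  rw [real_mul_cpow (inv_pos.2 (hpos n))]
  · push_cast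
    ring
  · intro h0
    have h5 : Complex.exp (-z * ((1 / ((n : ℝ) + 1) : ℝ) : ℂ)) = 1 := by linear_combination -h0
    have h6 : ‖Complex.exp (-z * ((1 / ((n : ℝ) + 1) : ℝ) : ℂ))‖ < 1 := by
      rw [Complex.norm_exp]
      apply Real.exp_lt_one_iff.2
      rw [Complex.re_mul_ofReal, Complex.neg_re, hzre]
      have := mul_pos hε (hpos n)
      linarith
    rw [h5] at h6
    simp at h6

theorem mult_stable {a : ℝ} (h1 : 1 < a) (h2 : a < 2) (σ : ℝ) {k : ℝ} (hk : 0 ≤ k) :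
    MultFn (fun t : ℝ => Complex.exp ((k : ℂ) * (-(Complex.I * σ * t)) ^ (a : ℂ))) := by
  have hpos : ∀ n : ℕ, 0 < (1 / ((n : ℝ) + 1)) := fun n => by positivity
  refine mult_lim (fun n => mult_tempered h1 h2 σ (hpos n) hk) (fun t => ?_)
  refine (Complex.continuous_exp.tendsto _).comp (Tendsto.const_mul _ ?_)
  have hc : ContinuousAt (fun z : ℂ => z ^ (a : ℂ)) (-(Complex.I * σ * t)) :=
    Complex.continuousAt_cpow_const_of_re_pos (Or.inl (by simp)) (by simp; linarith)
  refine hc.tendsto.comp ?_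
  have hc2 : Continuous (fun h : ℝ => (h : ℂ) - Complex.I * σ * t) := by fun_prop
  have := (hc2.tendsto 0).comp tendsto_one_div_add_atTop_nhds_zero_nat
  simpa [Function.comp_def] using this


/-! ### The basic oscillatory integrals -/

/-- Integrand `e^{-ity} t^p e^{-c t^a}`. -/
noncomputable def kern (c : ℂ) (a p y t : ℝ) : ℂ :=
  Complex.exp (-(Complex.I * (t : ℂ) * (y : ℂ))) * ((t ^ p : ℝ) : ℂ) *
    Complex.exp (-(c * ((t ^ a : ℝ) : ℂ)))

/-- `J_p(y) = ∫₀^∞ e^{-ity} t^p e^{-c t^a} dt`. -/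
noncomputable def Jint (c : ℂ) (a p y : ℝ) : ℂ := ∫ t in Ioi (0 : ℝ), kern c a p y t

/-- Uniform dominating function. -/
noncomputable def domB (t : ℝ) : ℝ := (t ^ (-(1 / 2) : ℝ) + t ^ (6 : ℝ)) * Real.exp (1 - t)

theorem domB_integrable : IntegrableOn domB (Ioi 0) := by
  have h1 := (Real.GammaIntegral_convergent (s := 1 / 2) (by norm_num)).const_mul (Real.exp 1)
  have h2 := (Real.GammaIntegral_convergent (s := 7) (by norm_num)).const_mul (Real.exp 1)
  refine (h1.add h2).congr (Eventually.of_forall fun t => ?_)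
  simp only [domB, sub_eq_add_neg, Real.exp_add, Pi.add_apply]
  norm_num
  ring

theorem norm_kern {c : ℂ} (hc : c.re = 1) (a p y : ℝ) {t : ℝ} (ht : 0 < t) :
    ‖kern c a p y t‖ = t ^ p * Real.exp (-t ^ a) := by
  rw [kern, norm_mul, norm_mul, Complex.norm_exp, Complex.norm_exp, Complex.norm_real,
    Real.norm_of_nonneg (Real.rpow_nonneg ht.le _)]
  simp [hc]

theorem rpow_exp_le_domB {a p : ℝ} (ha : 1 ≤ a) (hp : -(1 / 2) ≤ p)
    (hp' : p ≤ 6) {t : ℝ} (ht : 0 < t) : t ^ p * Real.exp (-t ^ a) ≤ domB t := by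
  have h1 : t ^ p ≤ t ^ (-(1 / 2) : ℝ) + t ^ (6 : ℝ) := by
    rcases le_total t 1 with h | h
    · have := Real.rpow_le_rpow_of_exponent_ge ht h hp
      have := Real.rpow_nonneg ht.le (6 : ℝ)
      linarith
    · have := Real.rpow_le_rpow_of_exponent_le h hp'
      have := Real.rpow_nonneg ht.le (-(1 / 2) : ℝ)
      linarith
  have h2 : -t ^ a ≤ 1 - t := by
    rcases le_total t 1 with h | h
    · have := Real.rpow_nonneg ht.le a
      linarith
    · have := Real.rpow_le_rpow_of_exponent_le h ha
      rw [Real.rpow_one] at this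
      linarith
  exact mul_le_mul h1 (Real.exp_le_exp.2 h2) (Real.exp_pos _).le
    (by have := Real.rpow_nonneg ht.le (6 : ℝ)
        have := Real.rpow_nonneg ht.le (-(1 / 2) : ℝ)
        linarith)

theorem kern_measurable (c : ℂ) (a p y : ℝ) : Measurable (kern c a p y) := by
  unfold kern
  fun_prop

theorem norm_kern_le {c : ℂ} (hc : c.re = 1) {a p : ℝ} (ha : 1 ≤ a) (hp : -(1 / 2) ≤ p)
    (hp' : p ≤ 6) (y : ℝ) {t : ℝ} (ht : 0 < t) : ‖kern c a p y t‖ ≤ domB t := by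
  rw [norm_kern hc a p y ht]
  exact rpow_exp_le_domB ha hp hp' ht

theorem kern_integrable {c : ℂ} (hc : c.re = 1) {a p : ℝ} (ha : 1 ≤ a)
    (hp : -(1 / 2) ≤ p) (hp' : p ≤ 6) (y : ℝ) : IntegrableOn (kern c a p y) (Ioi 0) :=
  Integrable.mono' domB_integrable (kern_measurable c a p y).aestronglyMeasurable
    ((ae_restrict_iff' measurableSet_Ioi).2 (Eventually.of_forall fun _ ht =>
      norm_kern_le hc ha hp hp' y ht))

/-- Uniform bound. -/
noncomputable def KB : ℝ := ∫ t in Ioi (0 : ℝ), domB t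

theorem Jint_bound {c : ℂ} (hc : c.re = 1) {a p : ℝ} (ha : 1 ≤ a) (hp : -(1 / 2) ≤ p)
    (hp' : p ≤ 6) (y : ℝ) : ‖Jint c a p y‖ ≤ KB :=
  norm_integral_le_of_norm_le domB_integrable
    ((ae_restrict_iff' measurableSet_Ioi).2 (Eventually.of_forall fun _ ht =>
      norm_kern_le hc ha hp hp' y ht))

/-- The complex constant `1 - iβ tan(πα/2)`. -/
noncomputable def cPar (α β : ℝ) : ℂ := 1 - Complex.I * β * (Real.tan (Real.pi * α / 2) : ℝ)

theorem cPar_re (α β : ℝ) : (cPar α β).re = 1 := by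
  simp [cPar, -Complex.ofReal_tan]

theorem stableDensity_eq (α β x : ℝ) :
    stableDensity α β x =
      (1 / π) * (Jint (cPar α β) α 0 (x + β * Real.tan (Real.pi * α / 2))).re := by
  unfold stableDensity Jint
  congr 2
  refine setIntegral_congr_fun measurableSet_Ioi fun t (ht : 0 < t) => ?_
  simp only [kern, cPar]
  rw [← Complex.exp_add, Real.rpow_zero, Complex.ofReal_one, mul_one, ← Complex.exp_add]
  have h : ((t ^ α : ℝ) : ℂ) * ((t ^ (1 - α) : ℝ) : ℂ) = t := by
    rw [← Complex.ofReal_mul, ← Real.rpow_add ht]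
    simp
  congr 1
  push_cast
  linear_combination (-(Complex.I * (β : ℂ) * Complex.tan (π * α / 2))) * h

/-! ### Nonnegativity of the density -/

theorem cpow_neg_I_mul (a : ℝ) {t : ℝ} (ht : 0 < t) :
    (-(Complex.I * t)) ^ (a : ℂ) =
      ((t ^ a : ℝ) : ℂ) * (Real.cos (π * a / 2) - Complex.I * Real.sin (π * a / 2)) := by
  have : -(Complex.I * (t : ℂ)) = (t : ℂ) * (-Complex.I) := by ring
  rw [this, real_mul_cpow ht (neg_ne_zero.2 Complex.I_ne_zero),
    Complex.cpow_def_of_ne_zero (neg_ne_zero.2 Complex.I_ne_zero), Complex.log_neg_I]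
  have h2 : -((π : ℂ) / 2) * Complex.I * (a : ℂ) = ((-(π * a / 2) : ℝ) : ℂ) * Complex.I := by
    push_cast; ring
  rw [h2, Complex.exp_mul_I, ← Complex.ofReal_cos, ← Complex.ofReal_sin, Real.cos_neg,
    Real.sin_neg]
  push_cast
  ring

theorem cpow_I_mul (a : ℝ) {t : ℝ} (ht : 0 < t) :
    (Complex.I * t) ^ (a : ℂ) =
      ((t ^ a : ℝ) : ℂ) * (Real.cos (π * a / 2) + Complex.I * Real.sin (π * a / 2)) := by
  have : (Complex.I * (t : ℂ)) = (t : ℂ) * (Complex.I) := by ring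
  rw [this, real_mul_cpow ht Complex.I_ne_zero,
    Complex.cpow_def_of_ne_zero Complex.I_ne_zero, Complex.log_I]
  have h2 : ((π : ℂ) / 2) * Complex.I * (a : ℂ) = (((π * a / 2) : ℝ) : ℂ) * Complex.I := by
    push_cast; ring
  rw [h2, Complex.exp_mul_I, ← Complex.ofReal_cos, ← Complex.ofReal_sin]
  ring

/-- The stable characteristic function on the whole line is a multiplier. -/
theorem exists_mult {α β : ℝ} (h1 : 1 < α) (h2 : α < 2) (hb : β ∈ Ioo (-1 : ℝ) 1) :
    ∃ m : ℝ → ℂ, MultFn m ∧ (∀ t : ℝ, 0 < t → m t = Complex.exp (-(cPar α β * ((t ^ α : ℝ) : ℂ)))) ∧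
      (∀ t : ℝ, 0 < t → m (-t) = (starRingEnd ℂ) (Complex.exp (-(cPar α β * ((t ^ α : ℝ) : ℂ))))) := by
  have hcos : Real.cos (π * α / 2) < 0 :=
    Real.cos_neg_of_pi_div_two_lt_of_lt (by nlinarith [Real.pi_pos]) (by nlinarith [Real.pi_pos])
  set C := Real.cos (π * α / 2) with hC
  set S := Real.sin (π * α / 2) with hS
  have hT : Real.tan (π * α / 2) = S / C := Real.tan_eq_sin_div_cos _
  have hC0 : (C : ℂ) ≠ 0 := by exact_mod_cast hcos.ne
  have hk1 : 0 ≤ (1 + β) / 2 * (-1 / C) :=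
    mul_nonneg (by linarith [hb.1]) (div_nonneg_of_nonpos (by norm_num) hcos.le)
  have hk2 : 0 ≤ (1 - β) / 2 * (-1 / C) :=
    mul_nonneg (by linarith [hb.2]) (div_nonneg_of_nonpos (by norm_num) hcos.le)
  refine ⟨_, mult_mul (mult_stable h1 h2 1 hk1) (mult_stable h1 h2 (-1) hk2), fun t ht => ?_,
    fun t ht => ?_⟩
  · have e1 : -(Complex.I * ((1 : ℝ) : ℂ) * (t : ℂ)) = -(Complex.I * t) := by push_cast; ring
    have e2 : -(Complex.I * ((-1 : ℝ) : ℂ) * (t : ℂ)) = (Complex.I * t) := by push_cast; ring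
    rw [e1, e2, cpow_neg_I_mul α ht, cpow_I_mul α ht, ← Complex.exp_add, cPar, hT, ← hC, ← hS]
    congr 1
    push_cast
    field_simp
    ring
  · have e1 : -(Complex.I * ((1 : ℝ) : ℂ) * ((-t : ℝ) : ℂ)) = (Complex.I * t) := by push_cast; ring
    have e2 : -(Complex.I * ((-1 : ℝ) : ℂ) * ((-t : ℝ) : ℂ)) = -(Complex.I * t) := by push_cast; ring
    rw [e1, e2, cpow_neg_I_mul α ht, cpow_I_mul α ht, ← Complex.exp_add, cPar, hT, ← hC, ← hS,
      ← Complex.exp_conj]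
    congr 1
    simp only [map_neg, map_mul, map_sub, map_one, Complex.conj_I, Complex.conj_ofReal]
    push_cast
    field_simp
    ring

theorem Jint_re_nonneg {α β : ℝ} (h1 : 1 < α) (h2 : α < 2) (hb : β ∈ Ioo (-1 : ℝ) 1) (y : ℝ) :
    0 ≤ (Jint (cPar α β) α 0 y).re := by
  obtain ⟨m, hm, hmp, hmn⟩ := exists_mult h1 h2 hb
  have hgood : GoodFn m := by simpa using hm.2.2 _ good_one
  obtain ⟨hmeas, ⟨C, hC⟩, hpos⟩ := hgood
  have hreg : ∀ ε : ℝ, 0 < ε → 0 ≤ (∫ t in Ioi (0 : ℝ),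
      Complex.exp (-(ε : ℂ) * (t : ℂ) ^ 2) * kern (cPar α β) α 0 y t).re := by
    intro ε hε
    have hp := hpos (-y) ε hε
    have hint := good_integrable hmeas hC (-y) hε
    have e1 : ∀ t : ℝ, 0 < t → Complex.exp (Complex.I * ((-y : ℝ) : ℂ) * t) *
        Complex.exp (-(ε : ℂ) * (t : ℂ) ^ 2) * m t =
        Complex.exp (-(ε : ℂ) * (t : ℂ) ^ 2) * kern (cPar α β) α 0 y t := by
      intro t ht
      rw [hmp t ht, kern, Real.rpow_zero]
      have : Complex.I * ((-y : ℝ) : ℂ) * (t : ℂ) = -(Complex.I * t * y) := by push_cast; ring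
      rw [this]
      push_cast
      ring
    have e2 : ∀ t : ℝ, 0 < t → Complex.exp (Complex.I * ((-y : ℝ) : ℂ) * ((-t : ℝ) : ℂ)) *
        Complex.exp (-(ε : ℂ) * ((-t : ℝ) : ℂ) ^ 2) * m (-t) =
        (starRingEnd ℂ) (Complex.exp (-(ε : ℂ) * (t : ℂ) ^ 2) * kern (cPar α β) α 0 y t) := by
      intro t ht
      rw [← e1 t ht, map_mul, map_mul, hmp t ht, ← hmn t ht, ← Complex.exp_conj, ← Complex.exp_conj]
      simp
    rw [← intervalIntegral.integral_Iic_add_Ioi (b := (0 : ℝ)) hint.integrableOn hint.integrableOn,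
      setIntegral_congr_fun measurableSet_Ioi (fun t ht => e1 t ht)] at hp
    have h3 := integral_comp_neg_Ioi (0 : ℝ) (fun t : ℝ => Complex.exp (Complex.I * ((-y : ℝ) : ℂ) * t) *
        Complex.exp (-(ε : ℂ) * (t : ℂ) ^ 2) * m t)
    rw [neg_zero] at h3
    rw [← h3, setIntegral_congr_fun measurableSet_Ioi (fun t ht => e2 t ht), integral_conj,
      Complex.add_re, Complex.conj_re] at hp
    linarith
  have hpos' : ∀ n : ℕ, 0 < (1 / ((n : ℝ) + 1)) := fun n => by positivity
  have hlim : Tendsto (fun n : ℕ => ∫ t in Ioi (0 : ℝ),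
      Complex.exp (-((1 / ((n : ℝ) + 1) : ℝ) : ℂ) * (t : ℂ) ^ 2) * kern (cPar α β) α 0 y t) atTop
      (𝓝 (Jint (cPar α β) α 0 y)) := by
    refine tendsto_integral_of_dominated_convergence domB
      (fun n => ?_) domB_integrable (fun n => ?_) (Eventually.of_forall fun t => ?_)
    · apply Measurable.aestronglyMeasurable
      have := kern_measurable (cPar α β) α 0 y
      fun_prop
    · refine (ae_restrict_iff' measurableSet_Ioi).2 (Eventually.of_forall fun t ht => ?_)
      rw [norm_mul, norm_exp_gauss]
      refine (mul_le_of_le_one_left (norm_nonneg _) (Real.exp_le_one_iff.2 ?_)).trans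
        (norm_kern_le (cPar_re α β) h1.le (by norm_num) (by norm_num) y ht)
      have := mul_nonneg (hpos' n).le (sq_nonneg t)
      linarith
    · have hc : Continuous (fun h : ℝ => Complex.exp (-(h : ℂ) * (t : ℂ) ^ 2) *
        kern (cPar α β) α 0 y t) := by fun_prop
      have := (hc.tendsto 0).comp tendsto_one_div_add_atTop_nhds_zero_nat
      simpa [Function.comp_def] using this
  exact ge_of_tendsto ((Complex.continuous_re.tendsto _).comp hlim)
    (Eventually.of_forall fun n => hreg _ (hpos' n))

theorem stableDensity_nonneg {α β : ℝ} (h1 : 1 < α) (h2 : α < 2) (hb : β ∈ Ioo (-1 : ℝ) 1)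
    (x : ℝ) : 0 ≤ stableDensity α β x := by
  rw [stableDensity_eq]
  exact mul_nonneg (by positivity) (Jint_re_nonneg h1 h2 hb _)


/-! ### Differentiation and integration by parts -/

theorem kern_succ (c : ℂ) (a p y : ℝ) {t : ℝ} (ht : 0 < t) :
    (t : ℂ) * kern c a p y t = kern c a (p + 1) y t := by
  rw [kern, kern, Real.rpow_add ht, Real.rpow_one]
  push_cast
  ring

theorem Jint_hasDerivAt {c : ℂ} (hc : c.re = 1) {a p : ℝ} (ha : 1 ≤ a) (hp : -(1 / 2) ≤ p)
    (hp' : p + 1 ≤ 6) (y : ℝ) :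
    HasDerivAt (Jint c a p) (-Complex.I * Jint c a (p + 1) y) y := by
  have h := (hasDerivAt_integral_of_dominated_loc_of_deriv_le (μ := volume.restrict (Ioi (0 : ℝ)))
    (F := fun y t => kern c a p y t) (F' := fun y t => -Complex.I * kern c a (p + 1) y t)
    (x₀ := y) (s := univ) (bound := domB) univ_mem
    (Eventually.of_forall fun z => (kern_measurable c a p z).aestronglyMeasurable)
    (kern_integrable hc ha hp (by linarith) y)
    ((kern_measurable c a (p + 1) y).const_mul _).aestronglyMeasurable
    ((ae_restrict_iff' measurableSet_Ioi).2 (Eventually.of_forall fun t ht z _ => ?_))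
    domB_integrable
    ((ae_restrict_iff' measurableSet_Ioi).2 (Eventually.of_forall fun t ht z _ => ?_))).2
  · rw [integral_const_mul] at h
    exact h
  · rw [norm_mul, norm_neg, Complex.norm_I, one_mul]
    exact norm_kern_le hc ha (by linarith) hp' z ht
  · rw [← kern_succ c a p z ht]
    unfold kern
    have h0 : HasDerivAt (fun z : ℝ => -(Complex.I * (t : ℂ) * (z : ℂ))) (-(Complex.I * t)) z := by
      have := ((Complex.ofRealCLM.hasDerivAt (x := z)).const_mul (Complex.I * (t : ℂ))).neg
      simp only [Complex.ofRealCLM_apply, Complex.ofReal_one, mul_one] at this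
      exact this
    have h1 := (h0.cexp.mul_const ((t ^ p : ℝ) : ℂ)).mul_const
      (Complex.exp (-(c * ((t ^ a : ℝ) : ℂ))))
    refine h1.congr_deriv ?_
    ring

theorem kern_hasDerivAt (c : ℂ) (a p y : ℝ) {t : ℝ} (ht : 0 < t) :
    HasDerivAt (kern c a p y)
      (-(Complex.I * y) * kern c a p y t + p * kern c a (p - 1) y t -
        c * a * kern c a (p + a - 1) y t) t := by
  have h0 : HasDerivAt (fun t : ℝ => -(Complex.I * (t : ℂ) * (y : ℂ))) (-(Complex.I * y)) t := by
    have := (((Complex.ofRealCLM.hasDerivAt (x := t)).const_mul (Complex.I)).mul_const (y : ℂ)).neg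
    simp only [Complex.ofRealCLM_apply, Complex.ofReal_one, mul_one] at this
    exact this
  have h1 : HasDerivAt (fun t : ℝ => ((t ^ p : ℝ) : ℂ)) ((p * t ^ (p - 1) : ℝ) : ℂ) t :=
    (Real.hasDerivAt_rpow_const (Or.inl ht.ne')).ofReal_comp
  have h2 : HasDerivAt (fun t : ℝ => -(c * ((t ^ a : ℝ) : ℂ))) (-(c * ((a * t ^ (a - 1) : ℝ) : ℂ))) t :=
    (((Real.hasDerivAt_rpow_const (Or.inl ht.ne')).ofReal_comp).const_mul c).neg
  have h3 := (h0.cexp.mul h1).mul h2.cexp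
  refine h3.congr_deriv ?_
  have e : t ^ (p + a - 1) = t ^ p * t ^ (a - 1) := by
    rw [← Real.rpow_add ht]; ring_nf
  simp only [kern, e, Pi.mul_apply]
  push_cast
  ring

theorem Jint_ibp {c : ℂ} (hc : c.re = 1) {a p : ℝ} (ha : 1 ≤ a) (hp : p = 0 ∨ 1 / 2 ≤ p)
    (hp' : p + a - 1 ≤ 6) (y : ℝ) :
    Complex.I * y * Jint c a p y =
      (((0 : ℝ) ^ p : ℝ) : ℂ) + p * Jint c a (p - 1) y - c * a * Jint c a (p + a - 1) y := by
  have hp0 : 0 ≤ p := by rcases hp with h | h <;> linarith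
  have i1 : IntegrableOn (fun t => -(Complex.I * y) * kern c a p y t) (Ioi 0) :=
    (kern_integrable hc ha (by linarith) (by linarith) y).const_mul _
  have i2 : IntegrableOn (fun t => (p : ℂ) * kern c a (p - 1) y t) (Ioi 0) := by
    rcases hp with h | h
    · simp only [h, Complex.ofReal_zero, zero_mul]
      exact integrableOn_zero
    · exact (kern_integrable hc ha (by linarith) (by linarith) y).const_mul _
  have i3 : IntegrableOn (fun t => c * a * kern c a (p + a - 1) y t) (Ioi 0) :=
    (kern_integrable hc ha (by linarith) (by linarith) y).const_mul _
  have hcont : ContinuousWithinAt (kern c a p y) (Ici 0) 0 := by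
    have q1 : Continuous (fun t : ℝ => t ^ p) := Real.continuous_rpow_const hp0
    have q2 : Continuous (fun t : ℝ => t ^ a) := Real.continuous_rpow_const (by linarith)
    apply Continuous.continuousWithinAt
    unfold kern
    fun_prop
  have hlim : Tendsto (kern c a p y) atTop (𝓝 0) := by
    have h1 := (tendsto_rpow_mul_exp_neg_mul_atTop_nhds_zero p 1 one_pos).const_mul
      (Real.exp 1)
    rw [mul_zero] at h1
    refine squeeze_zero_norm' ?_ h1
    filter_upwards [eventually_ge_atTop (1 : ℝ)] with t ht
    have ht0 : 0 < t := by linarith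
    rw [norm_kern hc a p y ht0, mul_left_comm, ← Real.exp_add]
    refine mul_le_mul_of_nonneg_left (Real.exp_le_exp.2 ?_) (Real.rpow_nonneg ht0.le _)
    have := Real.rpow_le_rpow_of_exponent_le ht ha
    rw [Real.rpow_one] at this
    linarith
  have h := integral_Ioi_of_hasDerivAt_of_tendsto hcont
    (fun t ht => kern_hasDerivAt c a p y ht) ((i1.add i2).sub i3) hlim
  have hs := integral_sub (i1.add i2) i3
  simp only [Pi.add_apply] at hs
  rw [hs, integral_add i1 i2, integral_const_mul, integral_const_mul,
    integral_const_mul] at h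
  have h0 : kern c a p y 0 = (((0 : ℝ) ^ p : ℝ) : ℂ) := by
    simp [kern, Real.zero_rpow (by linarith : a ≠ 0)]
  rw [h0] at h
  simp only [Jint]
  linear_combination -h

theorem KB_nonneg : 0 ≤ KB := by
  have := Jint_bound (c := 1) (by simp) (a := 1) (p := 0) le_rfl (by norm_num) (by norm_num) 0
  exact (norm_nonneg _).trans this

theorem yJ_bound {c : ℂ} (hc : c.re = 1) (hcn : ‖c‖ ≤ 2) {a : ℝ} (ha : 3 / 2 ≤ a) (ha' : a ≤ 2)
    (y : ℝ) {p : ℝ} (hp : p = 0 ∨ 1 / 2 ≤ p) (hp' : p ≤ 4) :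
    |y| * ‖Jint c a p y‖ ≤ 1 + 8 * KB := by
  have h := Jint_ibp hc (a := a) (by linarith) hp (by linarith) y
  have h2 := congrArg norm h
  rw [norm_mul, norm_mul, Complex.norm_I, one_mul, Complex.norm_real, Real.norm_eq_abs] at h2
  rw [h2]
  have hp0 : 0 ≤ p := by rcases hp with h | h <;> linarith
  have hK := KB_nonneg
  have n1 : ‖(((0 : ℝ) ^ p : ℝ) : ℂ)‖ ≤ 1 := by
    rw [Complex.norm_real, Real.norm_of_nonneg (Real.rpow_nonneg le_rfl _)]
    rcases hp with h | h
    · simp [h]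
    · rw [Real.zero_rpow (by linarith)]; norm_num
  have n2 : ‖(p : ℂ) * Jint c a (p - 1) y‖ ≤ 4 * KB := by
    rw [norm_mul, Complex.norm_real, Real.norm_of_nonneg hp0]
    rcases hp with h | h
    · rw [h]; simp; linarith
    · exact mul_le_mul hp' (Jint_bound hc (by linarith) (by linarith) (by linarith) y)
        (norm_nonneg _) (by norm_num)
  have n3 : ‖c * a * Jint c a (p + a - 1) y‖ ≤ 4 * KB := by
    rw [norm_mul, norm_mul, Complex.norm_real, Real.norm_of_nonneg (by linarith)]
    refine mul_le_mul ?_ (Jint_bound hc (by linarith) (by linarith) (by linarith) y)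
        (norm_nonneg _) (by norm_num)
    nlinarith [norm_nonneg c]
  calc _ ≤ _ := norm_sub_le _ _
    _ ≤ _ := add_le_add_left (norm_add_le _ _) _
    _ ≤ _ := by linarith

theorem J1_bound {c : ℂ} (hc : c.re = 1) (hcn : ‖c‖ ≤ 2) {a : ℝ} (ha : 3 / 2 ≤ a) (ha' : a ≤ 2)
    (y : ℝ) :
    |y| ^ 3 * |(-Complex.I * Jint c a 1 y).re| ≤ 28 * (1 + 8 * KB) := by
  have h1 := Jint_ibp hc (a := a) (by linarith) (p := 1) (Or.inr (by norm_num)) (by linarith) y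
  have h0 := Jint_ibp hc (a := a) (by linarith) (p := 0) (Or.inl rfl) (by linarith) y
  have ha1 := Jint_ibp hc (a := a) (by linarith) (p := a) (Or.inr (by linarith)) (by linarith) y
  have e1 : (1 : ℝ) - 1 = 0 := by norm_num
  have e2 : 1 + a - 1 = a := by ring
  have e3 : 0 + a - 1 = a - 1 := by ring
  rw [e1, e2, Real.zero_rpow one_ne_zero] at h1
  rw [e3, Real.rpow_zero] at h0
  rw [Real.zero_rpow (by linarith)] at ha1
  push_cast at h1 h0 ha1
  have key : (y : ℂ) ^ 2 * (-Complex.I * Jint c a 1 y) = Complex.I +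
      Complex.I * (-(c * a * (1 + a)) * Jint c a (a - 1) y + c ^ 2 * a ^ 2 * Jint c a (a + a - 1) y) := by
    linear_combination (Complex.I ^ 2 * y) * h1 + Complex.I * h0 - Complex.I * c * a * ha1 -
      Complex.I * (y : ℂ) ^ 2 * Jint c a 1 y * Complex.I_sq
  have b1 := yJ_bound hc hcn ha ha' y (p := a - 1) (Or.inr (by linarith)) (by linarith)
  have b2 := yJ_bound hc hcn ha ha' y (p := a + a - 1) (Or.inr (by linarith)) (by linarith)
  set R := -(c * a * (1 + a)) * Jint c a (a - 1) y + c ^ 2 * a ^ 2 * Jint c a (a + a - 1) y with hR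
  have hK := KB_nonneg
  have c1 : ‖c‖ * a ≤ 4 := by nlinarith [norm_nonneg c]
  have c0 : 0 ≤ ‖c‖ * a := mul_nonneg (norm_nonneg _) (by linarith)
  have hRn : |y| * ‖R‖ ≤ 28 * (1 + 8 * KB) := by
    have : ‖R‖ ≤ 12 * ‖Jint c a (a - 1) y‖ + 16 * ‖Jint c a (a + a - 1) y‖ := by
      refine (norm_add_le _ _).trans (add_le_add ?_ ?_)
      · rw [norm_mul, norm_neg, norm_mul, norm_mul]
        refine mul_le_mul_of_nonneg_right ?_ (norm_nonneg _)
        have q : ‖(1 : ℂ) + (a : ℂ)‖ = 1 + a := by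
          rw [← Complex.ofReal_one, ← Complex.ofReal_add, Complex.norm_real,
            Real.norm_of_nonneg (by linarith)]
        rw [q, Complex.norm_real, Real.norm_of_nonneg (by linarith)]
        nlinarith
      · rw [norm_mul, norm_mul, norm_pow, norm_pow, Complex.norm_real,
          Real.norm_of_nonneg (by linarith)]
        refine mul_le_mul_of_nonneg_right ?_ (norm_nonneg _)
        nlinarith
    have := mul_le_mul_of_nonneg_left this (abs_nonneg y)
    linarith
  have hre : |y| ^ 2 * |(-Complex.I * Jint c a 1 y).re| ≤ ‖R‖ := by
    have : y ^ 2 * (-Complex.I * Jint c a 1 y).re = (Complex.I * R).re := by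
      have := congrArg Complex.re key
      rw [Complex.add_re, Complex.I_re, zero_add, ← Complex.ofReal_pow, Complex.re_ofReal_mul] at this
      exact this
    rw [← abs_pow, ← abs_mul, this]
    refine (Complex.abs_re_le_norm _).trans ?_
    rw [norm_mul, Complex.norm_I, one_mul]
  have := mul_le_mul_of_nonneg_left hre (abs_nonneg y)
  calc _ = |y| * (|y| ^ 2 * |(-Complex.I * Jint c a 1 y).re|) := by ring
    _ ≤ _ := this
    _ ≤ _ := hRn

theorem J2_bound {c : ℂ} (hc : c.re = 1) (hcn : ‖c‖ ≤ 2) {a : ℝ} (ha : 3 / 2 ≤ a) (ha' : a ≤ 2)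
    (y : ℝ) :
    |y| ^ 3 * ‖Jint c a 2 y‖ ≤ 38 * (1 + 8 * KB) := by
  have h2 := Jint_ibp hc (a := a) (by linarith) (p := 2) (Or.inr (by norm_num)) (by linarith) y
  have h1 := Jint_ibp hc (a := a) (by linarith) (p := 1) (Or.inr (by norm_num)) (by linarith) y
  have ha1 := Jint_ibp hc (a := a) (by linarith) (p := a + 1) (Or.inr (by linarith)) (by linarith) y
  have e1 : (1 : ℝ) - 1 = 0 := by norm_num
  have e2 : 1 + a - 1 = a := by ring
  have e3 : (2 : ℝ) - 1 = 1 := by norm_num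
  have e4 : 2 + a - 1 = a + 1 := by ring
  have e5 : a + 1 - 1 = a := by ring
  have e6 : a + 1 + a - 1 = a + a := by ring
  rw [e3, e4, Real.zero_rpow two_ne_zero] at h2
  rw [e1, e2, Real.zero_rpow one_ne_zero] at h1
  rw [e5, e6, Real.zero_rpow (by linarith)] at ha1
  push_cast at h1 h2 ha1
  have key : (y : ℂ) ^ 2 * Jint c a 2 y = -(2 * Jint c a 0 y) + (c * a * (a + 3)) * Jint c a a y +
      -(c ^ 2 * a ^ 2 * Jint c a (a + a) y) := by
    linear_combination (-(Complex.I * y)) * h2 - 2 * h1 + c * a * ha1 +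
      (y : ℂ) ^ 2 * Jint c a 2 y * Complex.I_sq
  have b0 := yJ_bound hc hcn ha ha' y (p := 0) (Or.inl rfl) (by linarith)
  have b1 := yJ_bound hc hcn ha ha' y (p := a) (Or.inr (by linarith)) (by linarith)
  have b2 := yJ_bound hc hcn ha ha' y (p := a + a) (Or.inr (by linarith)) (by linarith)
  have hK := KB_nonneg
  have c1 : ‖c‖ * a ≤ 4 := by nlinarith [norm_nonneg c]
  have c0 : 0 ≤ ‖c‖ * a := mul_nonneg (norm_nonneg _) (by linarith)
  have hn : |y| ^ 2 * ‖Jint c a 2 y‖ ≤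
      2 * ‖Jint c a 0 y‖ + 20 * ‖Jint c a a y‖ + 16 * ‖Jint c a (a + a) y‖ := by
    have h3 := congrArg norm key
    rw [norm_mul, norm_pow, Complex.norm_real, Real.norm_eq_abs] at h3
    rw [h3]
    refine (norm_add_le _ _).trans (add_le_add ((norm_add_le _ _).trans (add_le_add ?_ ?_)) ?_)
    · rw [norm_neg, norm_mul]; simp
    · rw [norm_mul, norm_mul, norm_mul]
      refine mul_le_mul_of_nonneg_right ?_ (norm_nonneg _)
      have q : ‖(a : ℂ) + 3‖ = a + 3 := by
        have : (a : ℂ) + 3 = ((a + 3 : ℝ) : ℂ) := by push_cast; ring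
        rw [this, Complex.norm_real, Real.norm_of_nonneg (by linarith)]
      rw [q, Complex.norm_real, Real.norm_of_nonneg (by linarith)]
      nlinarith
    · rw [norm_neg, norm_mul, norm_mul, norm_pow, norm_pow, Complex.norm_real,
        Real.norm_of_nonneg (by linarith)]
      refine mul_le_mul_of_nonneg_right ?_ (norm_nonneg _)
      nlinarith
  have := mul_le_mul_of_nonneg_left hn (abs_nonneg y)
  calc _ = |y| * (|y| ^ 2 * ‖Jint c a 2 y‖) := by ring
    _ ≤ _ := this
    _ ≤ _ := by linarith


/-! ### An elementary inequality for nonnegative functions -/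

theorem sq_deriv_le {f f1 f2 : ℝ → ℝ} (hf : ∀ x, 0 ≤ f x) (h1 : ∀ x, HasDerivAt f (f1 x) x)
    (h2 : ∀ x, HasDerivAt f1 (f2 x) x) {x M : ℝ} (hM : ∀ s, |s - x| ≤ 1 → |f2 s| ≤ M)
    (hM1 : |f1 x| ≤ M) : f1 x ^ 2 ≤ 4 * M * f x := by
  have hM0 : 0 ≤ M := (abs_nonneg _).trans hM1
  rcases hM0.eq_or_lt with h0 | h0
  · rw [← h0] at hM1
    rw [abs_nonpos_iff.1 hM1, ← h0]; simp
  set h : ℝ := -f1 x / (2 * M) with hh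
  have hle : |h| ≤ 1 := by
    rw [hh, abs_div, abs_neg, abs_of_pos (by positivity : 0 < 2 * M), div_le_one (by positivity)]
    linarith
  have hb1 : ∀ s ∈ Metric.closedBall x |h|, |f1 s - f1 x| ≤ M * |h| := by
    intro s hs
    have := (convex_closedBall x |h|).norm_image_sub_le_of_norm_hasDerivWithin_le
      (f := f1) (f' := f2) (C := M) (fun z _ => (h2 z).hasDerivWithinAt)
      (fun z hz => by
        rw [Real.norm_eq_abs]
        apply hM
        rw [Metric.mem_closedBall, Real.dist_eq] at hz
        linarith) (Metric.mem_closedBall_self (abs_nonneg h)) hs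
    rw [Real.norm_eq_abs, Real.norm_eq_abs] at this
    rw [Metric.mem_closedBall, Real.dist_eq] at hs
    exact this.trans (mul_le_mul_of_nonneg_left hs hM0)
  have hb2 := (convex_closedBall x |h|).norm_image_sub_le_of_norm_hasDerivWithin_le
      (f := fun s => f s - f1 x * s) (f' := fun s => f1 s - f1 x) (C := M * |h|)
      (fun z _ => by
        have := (h1 z).sub ((hasDerivAt_id z).const_mul (f1 x))
        rw [mul_one] at this
        exact this.hasDerivWithinAt)
      (fun z hz => hb1 z hz) (Metric.mem_closedBall_self (abs_nonneg h))
      (y := x + h) (by simp)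
  rw [Real.norm_eq_abs, Real.norm_eq_abs, add_sub_cancel_left, mul_assoc, abs_mul_abs_self] at hb2
  have hb3 := (le_abs_self _).trans hb2
  have hb4 := hf (x + h)
  have e : f1 x = -(2 * M * h) := by rw [hh]; field_simp
  rw [e] at hb3 ⊢
  nlinarith


/-! ### Derivatives and uniform bounds of the density -/

/-- First derivative of the density. -/
noncomputable def gOne (α β x : ℝ) : ℝ :=
  (1 / π) * (-Complex.I * Jint (cPar α β) α 1 (x + β * Real.tan (Real.pi * α / 2))).re

/-- Second derivative of the density. -/
noncomputable def gTwo (α β x : ℝ) : ℝ :=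
  (1 / π) * (-Complex.I * (-Complex.I *
    Jint (cPar α β) α 2 (x + β * Real.tan (Real.pi * α / 2)))).re

theorem hasDerivAt_re {F : ℝ → ℂ} {F' : ℂ} {x : ℝ} (h : HasDerivAt F F' x) :
    HasDerivAt (fun t => (F t).re) F'.re x :=
  (Complex.reCLM.hasFDerivAt.comp_hasDerivAt x h)

theorem stableDensity_hasDerivAt {α : ℝ} (h1 : 1 ≤ α) (β x : ℝ) :
    HasDerivAt (stableDensity α β) (gOne α β x) x := by
  have h := Jint_hasDerivAt (cPar_re α β) h1 (p := 0) (by norm_num) (by norm_num)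
    (x + β * Real.tan (Real.pi * α / 2))
  rw [zero_add] at h
  have h' := (hasDerivAt_re (h.comp_add_const x _)).const_mul (1 / π)
  refine h'.congr_of_eventuallyEq (Eventually.of_forall fun z => ?_)
  exact stableDensity_eq α β z

theorem gOne_hasDerivAt {α : ℝ} (h1 : 1 ≤ α) (β x : ℝ) :
    HasDerivAt (gOne α β) (gTwo α β x) x := by
  have h := Jint_hasDerivAt (cPar_re α β) h1 (p := 1) (by norm_num) (by norm_num)
    (x + β * Real.tan (Real.pi * α / 2))
  rw [one_add_one_eq_two] at h
  exact (hasDerivAt_re ((h.comp_add_const x _).const_mul (-Complex.I))).const_mul (1 / π)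

theorem fX_eq {α : ℝ} (h1 : 1 ≤ α) (β : ℝ) : fX α β = gOne α β :=
  funext fun x => (stableDensity_hasDerivAt h1 β x).deriv

theorem cPar_norm {α β : ℝ} (h : |β * Real.tan (Real.pi * α / 2)| ≤ 1) : ‖cPar α β‖ ≤ 2 := by
  have : cPar α β = 1 - Complex.I * ((β * Real.tan (Real.pi * α / 2) : ℝ) : ℂ) := by
    rw [cPar]; push_cast; ring
  rw [this]
  refine (norm_sub_le _ _).trans ?_
  rw [norm_mul, Complex.norm_I, Complex.norm_real, norm_one, Real.norm_eq_abs]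
  linarith

/-- Uniform constant. -/
noncomputable def KC : ℝ := 4 * (8 * KB + 38 * (1 + 8 * KB))

theorem KC_nonneg : 0 ≤ KC := by
  have := KB_nonneg
  unfold KC; positivity

theorem cube_bound {x s v : ℝ} (hs : |s| ≤ 1) (h0 : |v| ≤ KB)
    (h3 : |x + s| ^ 3 * |v| ≤ 38 * (1 + 8 * KB)) :
    |1 / π * v| ≤ KC / (1 + |x|) ^ 3 := by
  rw [le_div_iff₀ (by positivity)]
  have hpi : |1 / π * v| ≤ |v| := by
    rw [abs_mul]
    refine mul_le_of_le_one_left (abs_nonneg _) ?_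
    rw [abs_of_pos (by positivity), div_le_one Real.pi_pos]
    linarith [Real.pi_gt_three]
  have hx : |x| ≤ |x + s| + 1 := by
    have := abs_sub_abs_le_abs_sub x (-s)
    rw [sub_neg_eq_add, abs_neg] at this
    linarith
  set r := |x + s| with hr
  have hr0 : 0 ≤ r := abs_nonneg _
  have hc : (1 + |x|) ^ 3 ≤ 4 * (8 + r ^ 3) := by
    have : (1 + |x|) ^ 3 ≤ (2 + r) ^ 3 :=
      pow_le_pow_left₀ (by positivity) (by linarith) 3
    nlinarith [mul_nonneg (by linarith : (0:ℝ) ≤ 2 + r) (sq_nonneg (r - 2))]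
  calc |1 / π * v| * (1 + |x|) ^ 3 ≤ |v| * (4 * (8 + r ^ 3)) :=
        mul_le_mul hpi hc (by positivity) (abs_nonneg _)
    _ ≤ KC := by
        unfold KC
        nlinarith

theorem gOne_bound {α β : ℝ} (h1 : 3 / 2 ≤ α) (h2 : α ≤ 2)
    (hs : |β * Real.tan (Real.pi * α / 2)| ≤ 1) (x : ℝ) :
    |gOne α β x| ≤ KC / (1 + |x|) ^ 3 := by
  have hK := KB_nonneg
  refine cube_bound hs ?_ ?_
  · refine (Complex.abs_re_le_norm _).trans ?_
    rw [norm_mul, norm_neg, Complex.norm_I, one_mul]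
    exact Jint_bound (cPar_re α β) (by linarith) (by norm_num) (by norm_num) _
  · refine (J1_bound (cPar_re α β) (cPar_norm hs) h1 h2 _).trans ?_
    linarith

theorem gTwo_bound {α β : ℝ} (h1 : 3 / 2 ≤ α) (h2 : α ≤ 2)
    (hs : |β * Real.tan (Real.pi * α / 2)| ≤ 1) (x : ℝ) :
    |gTwo α β x| ≤ KC / (1 + |x|) ^ 3 := by
  have hre : ∀ z : ℂ, |(-Complex.I * (-Complex.I * z)).re| ≤ ‖z‖ := fun z => by
    refine (Complex.abs_re_le_norm _).trans ?_
    rw [norm_mul, norm_mul, norm_neg, Complex.norm_I, one_mul, one_mul]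
  refine cube_bound hs ?_ ?_
  · exact (hre _).trans (Jint_bound (cPar_re α β) (by linarith) (by norm_num) (by norm_num) _)
  · exact (mul_le_mul_of_nonneg_left (hre _) (by positivity)).trans
      (J2_bound (cPar_re α β) (cPar_norm hs) h1 h2 _)

theorem integrand_bound {α β : ℝ} (h1 : 3 / 2 ≤ α) (h2 : α < 2) (hb : β ∈ Ioo (-1 : ℝ) 1)
    (hs : |β * Real.tan (Real.pi * α / 2)| ≤ 1) (x : ℝ) :
    |gOne α β x * (stableDensity α β x + x * gOne α β x) / stableDensity α β x| ≤
      33 * KC * (1 + x ^ 2)⁻¹ := by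
  have hK := KC_nonneg
  have hf := stableDensity_nonneg (α := α) (β := β) (by linarith) h2 hb
  have hg1 := gOne_bound h1 h2.le hs x
  set q := (1 + |x|) with hq
  have hq0 : 0 < q := by positivity
  have hsq : gOne α β x ^ 2 ≤ 4 * (8 * (KC / q ^ 3)) * stableDensity α β x := by
    refine sq_deriv_le hf (stableDensity_hasDerivAt (by linarith) β)
      (gOne_hasDerivAt (by linarith) β) (fun s hsx => ?_) ?_
    · refine (gTwo_bound h1 h2.le hs s).trans ?_
      have hh : q / 2 ≤ 1 + |s| := by
        have := abs_sub_abs_le_abs_sub x s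
        rw [abs_sub_comm] at this
        linarith [abs_nonneg s]
      have : (q / 2) ^ 3 ≤ (1 + |s|) ^ 3 := pow_le_pow_left₀ (by positivity) hh 3
      calc KC / (1 + |s|) ^ 3 ≤ KC / (q / 2) ^ 3 := by gcongr
        _ = 8 * (KC / q ^ 3) := by field_simp; norm_num
    · refine hg1.trans ?_
      have : 0 ≤ KC / q ^ 3 := by positivity
      linarith
  have hfin : 33 * (KC / q ^ 3) * q ≤ 33 * KC * (1 + x ^ 2)⁻¹ := by
    have e : 33 * (KC / q ^ 3) * q = 33 * KC * (q ^ 2)⁻¹ := by field_simp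
    rw [e]
    refine mul_le_mul_of_nonneg_left (inv_anti₀ (by positivity) ?_) (by positivity)
    rw [hq]
    nlinarith [sq_abs x, abs_nonneg x]
  rcases (hf x).eq_or_lt with h0 | h0
  · rw [← h0, div_zero, abs_zero]; positivity
  · refine le_trans ?_ hfin
    have e : gOne α β x * (stableDensity α β x + x * gOne α β x) / stableDensity α β x =
        gOne α β x + x * (gOne α β x ^ 2 / stableDensity α β x) := by
      field_simp
    rw [e]
    refine (abs_add_le _ _).trans ?_
    rw [abs_mul, abs_of_nonneg (by positivity : 0 ≤ gOne α β x ^ 2 / stableDensity α β x)]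
    have h4 : gOne α β x ^ 2 / stableDensity α β x ≤ 32 * (KC / q ^ 3) := by
      rw [div_le_iff₀ h0]; linarith
    have h5 := mul_le_mul_of_nonneg_left h4 (abs_nonneg x)
    have h6 : 0 ≤ KC / q ^ 3 := by positivity
    have h7 : |x| = q - 1 := by rw [hq]; ring
    rw [h7] at h5 ⊢
    nlinarith

/-! ### The Gaussian limit -/

theorem Jint_tendsto {p : ℝ} (hp : 0 ≤ p) (hp' : p ≤ 6) {c : ℝ → ℂ} {a y : ℝ → ℝ} {x : ℝ}
    (hc : ∀ d, (c d).re = 1) (hcl : Tendsto c (𝓝[>] 0) (𝓝 1))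
    (ha : ∀ᶠ d in 𝓝[>] (0 : ℝ), 1 ≤ a d) (hal : Tendsto a (𝓝[>] 0) (𝓝 2))
    (hy : Tendsto y (𝓝[>] 0) (𝓝 x)) :
    Tendsto (fun d => Jint (c d) (a d) p (y d)) (𝓝[>] 0) (𝓝 (Jint 1 2 p x)) := by
  refine tendsto_integral_filter_of_dominated_convergence domB
    (Eventually.of_forall fun d => (kern_measurable _ _ _ _).aestronglyMeasurable) ?_
    domB_integrable ((ae_restrict_iff' measurableSet_Ioi).2 (Eventually.of_forall fun t ht => ?_))
  · filter_upwards [ha] with d hd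
    exact (ae_restrict_iff' measurableSet_Ioi).2 (Eventually.of_forall fun t ht =>
      norm_kern_le (hc d) hd (by linarith) hp' _ ht)
  · unfold kern
    have ht0 : (0 : ℝ) < t := ht
    have h1 : Tendsto (fun d => ((y d : ℝ) : ℂ)) (𝓝[>] 0) (𝓝 (x : ℂ)) :=
      (Complex.continuous_ofReal.tendsto x).comp hy
    have h2 : Tendsto (fun d => ((t ^ (a d) : ℝ) : ℂ)) (𝓝[>] 0) (𝓝 ((t ^ (2 : ℝ) : ℝ) : ℂ)) :=
      (Complex.continuous_ofReal.tendsto _).comp (tendsto_const_nhds.rpow hal (Or.inl ht0.ne'))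
    exact (((Complex.continuous_exp.tendsto _).comp (h1.const_mul _).neg).mul_const _).mul
      ((Complex.continuous_exp.tendsto _).comp (hcl.mul h2).neg)

theorem Jint_neg (p x : ℝ) : Jint 1 2 p (-x) = (starRingEnd ℂ) (Jint 1 2 p x) := by
  rw [Jint, Jint, ← integral_conj]
  refine integral_congr_ae (Eventually.of_forall fun t => ?_)
  simp only [kern, map_mul, ← Complex.exp_conj, map_neg, Complex.conj_I, Complex.conj_ofReal,
    map_one]
  push_cast
  congr 3
  ring

theorem Jint_gauss_pos (x : ℝ) : 0 < (Jint 1 2 0 x).re := by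
  have hF := fourierIntegral_gaussian (b := 1) (by norm_num) (-x : ℂ)
  have hpos : 0 < (((π / 1 : ℂ)) ^ (1 / 2 : ℂ) * Complex.exp (-(-x : ℂ) ^ 2 / (4 * 1))).re := by
    have e : ((π / 1 : ℂ)) ^ (1 / 2 : ℂ) * Complex.exp (-(-x : ℂ) ^ 2 / (4 * 1)) =
        ((π ^ (1 / 2 : ℝ) * Real.exp (-x ^ 2 / 4) : ℝ) : ℂ) := by
      rw [Complex.ofReal_mul, Complex.ofReal_cpow Real.pi_pos.le]
      push_cast
      simp
    rw [e, Complex.ofReal_re]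
    positivity
  rw [← hF] at hpos
  have e1 : ∀ t : ℝ, 0 < t → Complex.exp (Complex.I * (-x : ℂ) * t) *
      Complex.exp (-1 * (t : ℂ) ^ 2) = kern 1 2 0 x t := by
    intro t ht
    rw [kern, Real.rpow_zero, Real.rpow_two]
    push_cast
    rw [mul_one]
    congr 2 <;> ring
  have e2 : ∀ t : ℝ, 0 < t → Complex.exp (Complex.I * (-x : ℂ) * ((-t : ℝ) : ℂ)) *
      Complex.exp (-1 * ((-t : ℝ) : ℂ) ^ 2) = (starRingEnd ℂ) (kern 1 2 0 x t) := by
    intro t ht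
    rw [← e1 t ht, map_mul, ← Complex.exp_conj, ← Complex.exp_conj]
    simp
  have hint : Integrable (fun t : ℝ => Complex.exp (Complex.I * (-x : ℂ) * t) *
      Complex.exp (-1 * (t : ℂ) ^ 2)) := by
    by_contra h
    rw [integral_undef h] at hpos
    simp at hpos
  rw [← intervalIntegral.integral_Iic_add_Ioi (b := (0 : ℝ)) hint.integrableOn hint.integrableOn,
    setIntegral_congr_fun measurableSet_Ioi (fun t ht => e1 t ht)] at hpos
  have h3 := integral_comp_neg_Ioi (0 : ℝ) (fun t : ℝ => Complex.exp (Complex.I * (-x : ℂ) * t) *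
      Complex.exp (-1 * (t : ℂ) ^ 2))
  rw [neg_zero] at h3
  rw [← h3, setIntegral_congr_fun measurableSet_Ioi (fun t ht => e2 t ht), integral_conj,
    Complex.add_re, Complex.conj_re] at hpos
  have : (∫ t in Ioi (0 : ℝ), kern 1 2 0 x t) = Jint 1 2 0 x := rfl
  rw [this] at hpos
  linarith

/-- Limit density. -/
noncomputable def limF (x : ℝ) : ℝ := (1 / π) * (Jint 1 2 0 x).re

/-- Derivative of the limit density. -/
noncomputable def limG (x : ℝ) : ℝ := (1 / π) * (-Complex.I * Jint 1 2 1 x).re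

theorem limF_pos (x : ℝ) : 0 < limF x :=
  mul_pos (by positivity) (Jint_gauss_pos x)

theorem lim_integral_zero : ∫ x : ℝ, limG x * (limF x + x * limG x) / limF x = 0 := by
  have h := integral_neg_eq_self (fun x : ℝ => limG x * (limF x + x * limG x) / limF x) volume
  have hF : ∀ x, limF (-x) = limF x := fun x => by
    rw [limF, limF, Jint_neg, Complex.conj_re]
  have hG : ∀ x, limG (-x) = -limG x := fun x => by
    rw [limG, limG, Jint_neg]; simp
  have e : ∀ x : ℝ, limG (-x) * (limF (-x) + -x * limG (-x)) / limF (-x) =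
      -(limG x * (limF x + x * limG x) / limF x) := fun x => by
    rw [hF, hG]; ring
  simp only [e, integral_neg] at h
  linarith

theorem fisher_information_mu_sigma (β : ℝ) (hβ : β ∈ Set.Ioo (-1 : ℝ) 1) :
    Filter.Tendsto
      (fun Δ : ℝ =>
        ∫ x : ℝ, fX (2 - Δ) β x * (stableDensity (2 - Δ) β x + x * fX (2 - Δ) β x) /
          stableDensity (2 - Δ) β x)
      (nhdsWithin 0 (Set.Ioi 0)) (nhds 0) := by
  have hA : Tendsto (fun Δ : ℝ => 2 - Δ) (𝓝[>] 0) (𝓝 2) := by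
    have : Continuous (fun Δ : ℝ => 2 - Δ) := by fun_prop
    have h := this.tendsto 0
    rw [sub_zero] at h
    exact h.mono_left nhdsWithin_le_nhds
  have hT : Tendsto (fun Δ : ℝ => β * Real.tan (Real.pi * (2 - Δ) / 2)) (𝓝[>] 0) (𝓝 0) := by
    have h1 : Tendsto (fun Δ : ℝ => Real.pi * (2 - Δ) / 2) (𝓝[>] 0) (𝓝 Real.pi) := by
      have h := (hA.const_mul Real.pi).div_const 2
      have e : Real.pi * 2 / 2 = Real.pi := by ring
      rwa [e] at h
    have h2 : ContinuousAt Real.tan Real.pi := by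
      rw [Real.continuousAt_tan]; simp
    have h3 := (h2.tendsto.comp h1).const_mul β
    rw [Real.tan_pi, mul_zero] at h3
    exact h3
  have hC : Tendsto (fun Δ : ℝ => cPar (2 - Δ) β) (𝓝[>] 0) (𝓝 1) := by
    have h := ((Complex.continuous_ofReal.tendsto 0).comp hT).const_mul Complex.I
    have h' := (tendsto_const_nhds (x := (1 : ℂ))).sub h
    rw [Complex.ofReal_zero, mul_zero, sub_zero] at h'
    refine h'.congr fun d => ?_
    simp only [cPar, Function.comp_apply]
    push_cast
    ring
  have hev1 : ∀ᶠ d in 𝓝[>] (0 : ℝ), 3 / 2 ≤ 2 - d :=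
    (hA.eventually (lt_mem_nhds (by norm_num : (3 / 2 : ℝ) < 2))).mono fun _ h => le_of_lt h
  have hev2 : ∀ᶠ d in 𝓝[>] (0 : ℝ), 2 - d < 2 := by
    filter_upwards [self_mem_nhdsWithin] with d hd
    have : (0 : ℝ) < d := hd
    linarith
  have hev3 : ∀ᶠ d in 𝓝[>] (0 : ℝ), |β * Real.tan (Real.pi * (2 - d) / 2)| ≤ 1 := by
    have h := hT.abs
    rw [abs_zero] at h
    exact (h.eventually (gt_mem_nhds (by norm_num : (0 : ℝ) < 1))).mono fun _ h => le_of_lt h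
  have hY : ∀ x : ℝ, Tendsto (fun d : ℝ => x + β * Real.tan (Real.pi * (2 - d) / 2)) (𝓝[>] 0)
      (𝓝 x) := fun x => by
    have h := hT.const_add x
    rwa [add_zero] at h
  have hone : ∀ᶠ d in 𝓝[>] (0 : ℝ), 1 ≤ 2 - d := hev1.mono fun _ h => by linarith
  have hz : 𝓝 (0 : ℝ) = 𝓝 (∫ x : ℝ, limG x * (limF x + x * limG x) / limF x) := by
    rw [lim_integral_zero]
  refine Tendsto.mono_right ?_ hz.ge
  refine tendsto_integral_filter_of_dominated_convergence
    (fun x : ℝ => 33 * KC * (1 + x ^ 2)⁻¹) ?_ ?_ (integrable_inv_one_add_sq.const_mul _) ?_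
  · filter_upwards [hone] with d hd
    rw [fX_eq hd]
    have m1 : Measurable (stableDensity (2 - d) β) :=
      (continuous_iff_continuousAt.2 fun x =>
        (stableDensity_hasDerivAt hd β x).continuousAt).measurable
    have m2 : Measurable (gOne (2 - d) β) :=
      (continuous_iff_continuousAt.2 fun x => (gOne_hasDerivAt hd β x).continuousAt).measurable
    exact ((m2.mul (m1.add (measurable_id.mul m2))).div m1).aestronglyMeasurable
  · filter_upwards [hone, hev1, hev2, hev3] with d hd h1 h2 h3
    rw [fX_eq hd]
    exact Eventually.of_forall fun x => integrand_bound h1 h2 hβ h3 x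
  · refine Eventually.of_forall fun x => ?_
    have hf : Tendsto (fun d : ℝ => stableDensity (2 - d) β x) (𝓝[>] 0) (𝓝 (limF x)) := by
      simp only [stableDensity_eq]
      exact ((Complex.continuous_re.tendsto _).comp (Jint_tendsto le_rfl (by norm_num)
        (fun d => cPar_re _ _) hC hone hA (hY x))).const_mul _
    have hg : Tendsto (fun d : ℝ => fX (2 - d) β x) (𝓝[>] 0) (𝓝 (limG x)) := by
      have : Tendsto (fun d : ℝ => gOne (2 - d) β x) (𝓝[>] 0) (𝓝 (limG x)) := by
        unfold gOne limG
        exact ((Complex.continuous_re.tendsto _).comp ((Jint_tendsto zero_le_one (by norm_num)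
          (fun d => cPar_re _ _) hC hone hA (hY x)).const_mul _)).const_mul _
      refine this.congr' ?_
      filter_upwards [hone] with d hd
      rw [fX_eq hd]
    exact (hg.mul (hf.add (hg.const_mul x))).div hf (limF_pos x).ne'
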